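/- Let the feasible semidefinite system (P_SD) satisfy the assumption that Z = diag(I_r, 0) is a maximum rank slack. Then (P_SD) is badly behaved if and only if the Bad condition holds: there exists a linear combination V = Σ_{i=1}^m λ_i A_i with block form V = [[V_11, V_12],[V_12ᵀ, V_22]] (upper-left block V_11 of size r×r) such that V_22 is positive semidefinite and the column space of V_12ᵀ is not contained in the column space of V_22. -/

import Mathlib

open Matrix

/-- Trace inner product `S • T = trace(ST)` of square real matrices. -/
noncomputable def ip {k : ℕ} (S T : Matrix (Fin k) (Fin k) ℝ) : ℝ :=
  Matrix.trace (S * T)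

/-- `x` is feasible for the semidefinite system `∑ xᵢ Aᵢ ⪯ B`. -/
def IsFeasible {n m : ℕ} (A : Fin m → Matrix (Fin n) (Fin n) ℝ)
    (B : Matrix (Fin n) (Fin n) ℝ) (x : Fin m → ℝ) : Prop :=
  (B - ∑ i, x i • A i).PosSemidef

/-- The set of primal objective values `∑ cᵢ xᵢ` over feasible `x`. -/
def PrimalVals {n m : ℕ} (A : Fin m → Matrix (Fin n) (Fin n) ℝ)
    (B : Matrix (Fin n) (Fin n) ℝ) (c : Fin m → ℝ) : Set ℝ :=
  {s | ∃ x : Fin m → ℝ, IsFeasible A B x ∧ s = ∑ i, c i * x i}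

/-- The system `∑ xᵢ Aᵢ ⪯ B` is badly behaved: for some `c` the primal optimal
value is finite (i.e. is a least upper bound `v`), but no dual feasible `Y`
achieves value `v`. -/
def BadlyBehaved {n m : ℕ} (A : Fin m → Matrix (Fin n) (Fin n) ℝ)
    (B : Matrix (Fin n) (Fin n) ℝ) : Prop :=
  ∃ (c : Fin m → ℝ) (v : ℝ), IsLUB (PrimalVals A B c) v ∧
    ¬ ∃ Y : Matrix (Fin n) (Fin n) ℝ,
        Y.PosSemidef ∧ (∀ i, ip (A i) Y = c i) ∧ ip B Y = v

/-- `Zmat n r = diag(I_r, 0)`. -/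
def Zmat (n r : ℕ) : Matrix (Fin n) (Fin n) ℝ :=
  Matrix.of fun i j => if i = j ∧ (i : ℕ) < r then (1 : ℝ) else 0

/-- `Zmat n r` is a maximum rank slack of `∑ xᵢ Aᵢ ⪯ B`:
it is a slack and every slack has rank at most `r`. -/
def MaxRankSlack {n m : ℕ} (A : Fin m → Matrix (Fin n) (Fin n) ℝ)
    (B : Matrix (Fin n) (Fin n) ℝ) (r : ℕ) : Prop :=
  (∃ x : Fin m → ℝ, B - ∑ i, x i • A i = Zmat n r) ∧
  ∀ x : Fin m → ℝ, IsFeasible A B x → (B - ∑ i, x i • A i).rank ≤ r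

/-- Lower-right `(n-r) × (n-r)` block. -/
def block22 {n : ℕ} (r : ℕ) (h : r ≤ n) (V : Matrix (Fin n) (Fin n) ℝ) :
    Matrix (Fin (n - r)) (Fin (n - r)) ℝ :=
  Matrix.of fun i j => V ⟨r + i.1, by omega⟩ ⟨r + j.1, by omega⟩

/-- Upper-right `r × (n-r)` block. -/
def block12 {n : ℕ} (r : ℕ) (h : r ≤ n) (V : Matrix (Fin n) (Fin n) ℝ) :
    Matrix (Fin r) (Fin (n - r)) ℝ :=
  Matrix.of fun i j => V ⟨i.1, by omega⟩ ⟨r + j.1, by omega⟩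

/-- The column space (range space) of a matrix. -/
def colSpace {p q : ℕ} (M : Matrix (Fin p) (Fin q) ℝ) : Submodule ℝ (Fin p → ℝ) :=
  LinearMap.range M.mulVecLin

/-- The "Bad condition": some linear combination `V` of the `Aᵢ` has `V₂₂ ⪰ 0`
and `ℛ(V₁₂ᵀ) ⊄ ℛ(V₂₂)`. -/
def BadCond {n m : ℕ} (A : Fin m → Matrix (Fin n) (Fin n) ℝ) (r : ℕ) (h : r ≤ n) : Prop :=
  ∃ lam : Fin m → ℝ,
    (block22 r h (∑ i, lam i • A i)).PosSemidef ∧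
    ¬ colSpace (block12 r h (∑ i, lam i • A i))ᵀ ≤
        colSpace (block22 r h (∑ i, lam i • A i))

/-- `padLow r h U = diag(0, U)` as an `n × n` matrix. -/
def padLow {n : ℕ} (r : ℕ) (h : r ≤ n) (U : Matrix (Fin (n - r)) (Fin (n - r)) ℝ) :
    Matrix (Fin n) (Fin n) ℝ :=
  Matrix.of fun a b =>
    if hab : r ≤ (a : ℕ) ∧ r ≤ (b : ℕ) then U ⟨a.1 - r, by omega⟩ ⟨b.1 - r, by omega⟩
    else 0

/-- "Good condition 1": some positive definite `U` has `Aᵢ • diag(0, U) = 0` for all `i`. -/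
def GoodCond1 {n m : ℕ} (A : Fin m → Matrix (Fin n) (Fin n) ℝ) (r : ℕ) (h : r ≤ n) : Prop :=
  ∃ U : Matrix (Fin (n - r)) (Fin (n - r)) ℝ, U.PosDef ∧ ∀ i, ip (A i) (padLow r h U) = 0

/-- "Good condition 2": every linear combination of the `Aᵢ` with zero lower-right
block has zero upper-right block. -/
def GoodCond2 {n m : ℕ} (A : Fin m → Matrix (Fin n) (Fin n) ℝ) (r : ℕ) (h : r ≤ n) : Prop :=
  ∀ lam : Fin m → ℝ, block22 r h (∑ i, lam i • A i) = 0 →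
    block12 r h (∑ i, lam i • A i) = 0

/-- `Tmat r h N = [[I_r, 0], [0, N]]`. -/
def Tmat {n : ℕ} (r : ℕ) (h : r ≤ n) (N : Matrix (Fin (n - r)) (Fin (n - r)) ℝ) :
    Matrix (Fin n) (Fin n) ℝ :=
  Matrix.of fun a b =>
    if (a : ℕ) < r ∧ (b : ℕ) < r then (if a = b then (1 : ℝ) else 0)
    else if hab : r ≤ (a : ℕ) ∧ r ≤ (b : ℕ) then N ⟨a.1 - r, by omega⟩ ⟨b.1 - r, by omega⟩
    else 0

/-- The system `∑ xᵢ A'ᵢ ⪯ B'` is an elementary reformulation of `∑ xᵢ Aᵢ ⪯ B`: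
there are an invertible `M : ℝ^{m×m}`, a vector `μ ∈ ℝ^m` and an invertible
`T = [[I_r, 0], [0, N]]` with `A'ᵢ = Tᵀ (∑ⱼ Mᵢⱼ Aⱼ) T` and `B' = Tᵀ (B + ∑ⱼ μⱼ Aⱼ) T`. -/
def ElemReform {n m : ℕ} (r : ℕ) (h : r ≤ n)
    (A : Fin m → Matrix (Fin n) (Fin n) ℝ) (B : Matrix (Fin n) (Fin n) ℝ)
    (A' : Fin m → Matrix (Fin n) (Fin n) ℝ) (B' : Matrix (Fin n) (Fin n) ℝ) : Prop :=
  ∃ (M : Matrix (Fin m) (Fin m) ℝ) (μ : Fin m → ℝ)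
    (N : Matrix (Fin (n - r)) (Fin (n - r)) ℝ),
    IsUnit M ∧ IsUnit (Tmat r h N) ∧
    (∀ i, A' i = (Tmat r h N)ᵀ * (∑ j, M i j • A j) * Tmat r h N) ∧
    B' = (Tmat r h N)ᵀ * (B + ∑ j, μ j • A j) * Tmat r h N

/-- The last `n - r` columns of a square matrix, as an `n × (n-r)` matrix. -/
def lastCols {n : ℕ} (r : ℕ) (h : r ≤ n) (V : Matrix (Fin n) (Fin n) ℝ) :
    Matrix (Fin n) (Fin (n - r)) ℝ :=
  Matrix.of fun a j => V a ⟨r + j.1, by omega⟩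

/-- Bad normal form of a semidefinite system. -/
def BadNormalForm {n m : ℕ} (A : Fin m → Matrix (Fin n) (Fin n) ℝ)
    (B : Matrix (Fin n) (Fin n) ℝ) (r : ℕ) (h : r ≤ n) : Prop :=
  B = Zmat n r ∧ MaxRankSlack A B r ∧
  ∃ k : ℕ, ∃ hk : k < m,
    (∀ i : Fin m, (i : ℕ) < k → ∀ a b : Fin n, r ≤ (b : ℕ) → A i a b = 0) ∧
    (∀ i : Fin m, (i : ℕ) < k → ∀ a b : Fin n, r ≤ (a : ℕ) → A i a b = 0) ∧
    LinearIndependent ℝ (fun i : Fin (m - k) => lastCols r h (A ⟨k + i.1, by omega⟩)) ∧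
    (block22 r h (A ⟨m - 1, by omega⟩)).PosSemidef

/-- Good normal form of a semidefinite system. -/
def GoodNormalForm {n m : ℕ} (A : Fin m → Matrix (Fin n) (Fin n) ℝ)
    (B : Matrix (Fin n) (Fin n) ℝ) (r : ℕ) (h : r ≤ n) : Prop :=
  B = Zmat n r ∧ MaxRankSlack A B r ∧
  ∃ k : ℕ, ∃ _hk : k ≤ m,
    (∀ i : Fin m, (i : ℕ) < k → ∀ a b : Fin n,
        (r ≤ (a : ℕ) ∨ r ≤ (b : ℕ)) → A i a b = 0) ∧
    LinearIndependent ℝ (fun i : Fin (m - k) => block22 r h (A ⟨k + i.1, by omega⟩)) ∧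
    ∃ U : Matrix (Fin (n - r)) (Fin (n - r)) ℝ, U.PosDef ∧
      ∀ i : Fin m, k ≤ (i : ℕ) → ip (block22 r h (A i)) U = 0

/-- The image of the positive semidefinite cone under `Y ↦ (A₁ • Y, …, A_m • Y)`. -/
def imageSet {n m : ℕ} (A : Fin m → Matrix (Fin n) (Fin n) ℝ) : Set (Fin m → ℝ) :=
  {y | ∃ Y : Matrix (Fin n) (Fin n) ℝ, Y.PosSemidef ∧ ∀ i, ip (A i) Y = y i}

section ConvexDuality

/-- A linear functional vanishing on the kernel of a linear map factors through that map. -/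
lemma exists_comp_eq_of_ker_le {X E : Type*} [AddCommGroup X] [Module ℝ X]
    [AddCommGroup E] [Module ℝ E] (f : X →ₗ[ℝ] E) (φ : X →ₗ[ℝ] ℝ)
    (h : ∀ x, f x = 0 → φ x = 0) : ∃ g : E →ₗ[ℝ] ℝ, ∀ x, g (f x) = φ x := by
  have hφ : φ ∈ LinearMap.range f.dualMap := by
    rw [LinearMap.range_dualMap_eq_dualAnnihilator_ker, Submodule.mem_dualAnnihilator]
    exact fun x hx => h x hx
  obtain ⟨g, rfl⟩ := hφ
  exact ⟨g, fun x => rfl⟩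

/-- Riesz extension for a functional prescribed along a linear map. -/
lemma exists_nonneg_functional_comp_eq {X E : Type*} [AddCommGroup X] [Module ℝ X]
    [AddCommGroup E] [Module ℝ E] (s : PointedCone ℝ E) (f : X →ₗ[ℝ] E) (φ : X →ₗ[ℝ] ℝ)
    (nonneg : ∀ x, f x ∈ s → 0 ≤ φ x) (dense : ∀ y, ∃ x, f x + y ∈ s) :
    ∃ g : E →ₗ[ℝ] ℝ, (∀ x, g (f x) = φ x) ∧ ∀ y ∈ s, 0 ≤ g y := by
  have hker : ∀ x, f x = 0 → φ x = 0 := fun x hx =>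
    le_antisymm
      (by simpa using nonneg (-x) (by rw [map_neg, hx, neg_zero]; exact zero_mem s))
      (nonneg x (by rw [hx]; exact zero_mem s))
  obtain ⟨g₀, hg₀⟩ := exists_comp_eq_of_ker_le f φ hker
  obtain ⟨g, hg, hgs⟩ := riesz_extension s
    (⟨LinearMap.range f, g₀.comp (LinearMap.range f).subtype⟩ : E →ₗ.[ℝ] ℝ)
    (by
      rintro ⟨_, x, rfl⟩ hx
      exact (nonneg x hx).trans_eq (hg₀ x).symm)
    (fun y => by
      obtain ⟨x, hx⟩ := dense y
      exact ⟨⟨f x, x, rfl⟩, hx⟩)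
  refine ⟨g, fun x => ?_, hgs⟩
  rw [← hg₀ x]
  exact hg ⟨f x, x, rfl⟩

end ConvexDuality

section PosSemidef

variable {ι : Type*} [Fintype ι]

/-- Every quadratic form is dominated by a positive multiple of the squared norm. -/
lemma exists_abs_quadForm_le (M : Matrix ι ι ℝ) :
    ∃ t > 0, ∀ x : ι → ℝ, |x ⬝ᵥ M *ᵥ x| ≤ t * (x ⬝ᵥ x) := by
  refine ⟨1 + ∑ i, ∑ j, |M i j|, by positivity, fun x => ?_⟩
  have hx (i : ι) : x i ^ 2 ≤ x ⬝ᵥ x := by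
    rw [pow_two]
    exact Finset.single_le_sum (f := fun i => x i * x i) (fun i _ => mul_self_nonneg _)
      (Finset.mem_univ i)
  have hxx : 0 ≤ x ⬝ᵥ x := Finset.sum_nonneg fun i _ => mul_self_nonneg _
  have key : |x ⬝ᵥ M *ᵥ x| ≤ (∑ i, ∑ j, |M i j|) * (x ⬝ᵥ x) := by
    rw [show x ⬝ᵥ M *ᵥ x = ∑ i, ∑ j, M i j * (x i * x j) by
        simp only [dotProduct, mulVec, Finset.mul_sum]
        exact Finset.sum_congr rfl fun i _ => Finset.sum_congr rfl fun j _ => by ring]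
    simp only [Finset.sum_mul]
    refine (Finset.abs_sum_le_sum_abs _ _).trans (Finset.sum_le_sum fun i _ => ?_)
    refine (Finset.abs_sum_le_sum_abs _ _).trans (Finset.sum_le_sum fun j _ => ?_)
    rw [abs_mul]
    refine mul_le_mul_of_nonneg_left ?_ (abs_nonneg _)
    have h1 := hx i
    have h2 := hx j
    rw [abs_le]
    constructor <;> nlinarith [sq_nonneg (x i + x j), sq_nonneg (x i - x j)]
  linarith

/-- The cone of square matrices with nonnegative quadratic form. -/
def quadFormCone (ι : Type*) [Fintype ι] : PointedCone ℝ (Matrix ι ι ℝ) where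
  carrier := {M | ∀ x : ι → ℝ, 0 ≤ x ⬝ᵥ M *ᵥ x}
  add_mem' ha hb x := by
    rw [add_mulVec, dotProduct_add]
    exact add_nonneg (ha x) (hb x)
  zero_mem' x := by simp
  smul_mem' c M hM x := by
    have : x ⬝ᵥ (c • M) *ᵥ x = (c : ℝ) * (x ⬝ᵥ M *ᵥ x) := by
      rw [← smul_eq_mul, ← dotProduct_smul, ← smul_mulVec]
      rfl
    rw [this]
    exact mul_nonneg c.2 (hM x)

lemma posSemidef_iff_isSymm_and_quadForm {M : Matrix ι ι ℝ} :
    M.PosSemidef ↔ M.IsSymm ∧ ∀ x : ι → ℝ, 0 ≤ x ⬝ᵥ M *ᵥ x := by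
  rw [posSemidef_iff_dotProduct_mulVec]
  simp [IsHermitian, IsSymm]

lemma Matrix.PosSemidef.trace_mul_nonneg {M Y : Matrix ι ι ℝ} (hM : M.PosSemidef)
    (hY : Y.PosSemidef) : 0 ≤ (M * Y).trace := by
  obtain ⟨k, v, rfl⟩ := posSemidef_iff_eq_sum_vecMulVec.mp hM
  rw [Finset.sum_mul, trace_sum]
  refine Finset.sum_nonneg fun i _ => ?_
  rw [trace_mul_comm, mul_vecMulVec, trace_vecMulVec, dotProduct_comm]
  exact hY.dotProduct_mulVec_nonneg (v i)

/-- A functional nonnegative on the positive semidefinite cone is the trace inner product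
with some positive semidefinite matrix. -/
lemma exists_posSemidef_trace_mul_eq (g : Matrix ι ι ℝ →ₗ[ℝ] ℝ)
    (hg : ∀ M : Matrix ι ι ℝ, M.PosSemidef → 0 ≤ g M) :
    ∃ Y : Matrix ι ι ℝ, Y.PosSemidef ∧ ∀ M : Matrix ι ι ℝ, M.IsSymm → (M * Y).trace = g M := by
  classical
  let Y : Matrix ι ι ℝ := of fun i j => (g (single i j 1) + g (single j i 1)) / 2
  have hrep (M : Matrix ι ι ℝ) : g M = ∑ i, ∑ j, M i j * g (single i j 1) := by
    conv_lhs => rw [matrix_eq_sum_single M]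
    simp only [map_sum]
    refine Finset.sum_congr rfl fun i _ => Finset.sum_congr rfl fun j _ => ?_
    rw [← smul_eq_mul, ← map_smul, smul_single, smul_eq_mul, mul_one]
  have htr (M : Matrix ι ι ℝ) (hM : M.IsSymm) : (M * Y).trace = g M := by
    have h2 : g M = ∑ i, ∑ j, M i j * g (single j i 1) := by
      rw [hrep, Finset.sum_comm]
      simp only [fun i j => hM.apply i j]
    have : (M * Y).trace = (g M + g M) / 2 := by
      nth_rw 1 [hrep M]
      rw [h2]
      simp only [trace, diag, mul_apply, Y, of_apply, ← Finset.sum_add_distrib, Finset.sum_div]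
      refine Finset.sum_congr rfl fun i _ => Finset.sum_congr rfl fun j _ => ?_
      ring
    rw [this]
    ring
  refine ⟨Y, posSemidef_iff_isSymm_and_quadForm.mpr ⟨?_, fun x => ?_⟩, htr⟩
  · ext i j
    simp [Y, add_comm]
  · have hx : (vecMulVec x x).PosSemidef := by simpa using posSemidef_vecMulVec_self_star x
    have := hg _ hx
    rw [← htr _ (posSemidef_iff_isSymm_and_quadForm.mp hx).1, trace_mul_comm] at this
    convert this using 1
    rw [mul_vecMulVec, trace_vecMulVec, dotProduct_comm]

lemma Matrix.PosSemidef.abs_apply_le_trace {M : Matrix ι ι ℝ} (hM : M.PosSemidef) (i j : ι) :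
    |M i j| ≤ M.trace := by
  classical
  have hd (k : ι) : M k k ≤ M.trace :=
    Finset.single_le_sum (f := fun k => M k k) (fun k _ => hM.diag_nonneg) (Finset.mem_univ k)
  obtain ⟨hs, hq⟩ := posSemidef_iff_isSymm_and_quadForm.mp hM
  have h1 := hq (Pi.single i 1 + Pi.single j 1)
  have h2 := hq (Pi.single i 1 - Pi.single j 1)
  have hij := hs.apply i j
  simp [mulVec_add, mulVec_sub, hij] at h1 h2
  rw [abs_le]
  constructor <;> linarith [hd i, hd j]

lemma isCompact_posSemidef_trace_eq_one :
    IsCompact {M : Matrix ι ι ℝ | M.PosSemidef ∧ M.trace = 1} := by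
  have hbox : IsCompact (Set.pi Set.univ fun _ : ι => Set.pi Set.univ fun _ : ι =>
      Set.Icc (-1 : ℝ) 1) :=
    isCompact_univ_pi fun _ => isCompact_univ_pi fun _ => isCompact_Icc
  refine IsCompact.of_isClosed_subset (X := Matrix ι ι ℝ) hbox ?_ ?_
  · simp only [posSemidef_iff_isSymm_and_quadForm, Set.ofPred_and, Set.ofPred_forall]
    refine ((isClosed_eq ?_ ?_).inter (isClosed_iInter fun x => isClosed_le ?_ ?_)).inter
      (isClosed_eq ?_ ?_) <;> fun_prop
  · rintro M ⟨hM, ht⟩ i - j -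
    have := hM.abs_apply_le_trace i j
    rw [ht] at this
    exact abs_le.mp this

/-- If a linear space of matrices meets the positive semidefinite cone only at zero, then every
functional on it extends to one that is nonnegative on the cone. -/
lemma exists_nonneg_on_posSemidef_comp_eq {X : Type*} [AddCommGroup X] [Module ℝ X]
    (f : X →ₗ[ℝ] Matrix ι ι ℝ) (hf : ∀ x, (f x).PosSemidef → f x = 0)
    (ψ : X →ₗ[ℝ] ℝ) (hψ : ∀ x, f x = 0 → ψ x = 0) :
    ∃ h : Matrix ι ι ℝ →ₗ[ℝ] ℝ, (∀ x, h (f x) = ψ x) ∧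
      ∀ M : Matrix ι ι ℝ, M.PosSemidef → 0 ≤ h M := by
  obtain ⟨W, hW⟩ := exists_comp_eq_of_ker_le f ψ hψ
  set S : Set (Matrix ι ι ℝ) := {M | M.PosSemidef ∧ M.trace = 1}
  have hScomp : IsCompact S := isCompact_posSemidef_trace_eq_one
  have hSconv : Convex ℝ S := by
    rintro M ⟨hM, hMt⟩ N ⟨hN, hNt⟩ a b ha hb hab
    refine ⟨(hM.smul ha).add (hN.smul hb), ?_⟩
    rw [trace_add, trace_smul, trace_smul, hMt, hNt]
    simpa using hab
  have : LocallyConvexSpace ℝ (Matrix ι ι ℝ) :=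
    inferInstanceAs (LocallyConvexSpace ℝ (ι → ι → ℝ))
  have hdisj : Disjoint S (LinearMap.range f : Set (Matrix ι ι ℝ)) := by
    rw [Set.disjoint_left]
    rintro _ ⟨hM, ht⟩ ⟨x, rfl⟩
    rw [hf x hM] at ht
    simp at ht
  obtain ⟨F, u, v, hFS, huv, hFL⟩ := geometric_hahn_banach_compact_closed hSconv hScomp
    (LinearMap.range f).convex (LinearMap.range f).closed_of_finiteDimensional hdisj
  have hv : v < 0 := by simpa using hFL 0 (zero_mem _)
  have hF0 (x : X) : F (f x) = 0 := by
    by_contra hne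
    have := hFL ((v / F (f x)) • f x) (Submodule.smul_mem _ _ ⟨x, rfl⟩)
    rw [map_smul, smul_eq_mul, div_mul_cancel₀ _ hne] at this
    exact lt_irrefl _ this
  have hWc : Continuous W := W.continuous_of_finiteDimensional
  obtain ⟨C, hC⟩ := (hScomp.image hWc).bddBelow
  have hu : u < 0 := huv.trans hv
  refine ⟨W - (|C| / (-u)) • (F : Matrix ι ι ℝ →ₗ[ℝ] ℝ), fun x => by simp [hW, hF0],
    fun M hM => ?_⟩
  set h := W - (|C| / (-u)) • (F : Matrix ι ι ℝ →ₗ[ℝ] ℝ) with hh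
  have hhS : ∀ N ∈ S, 0 ≤ h N := by
    intro N hN
    have h1 : C ≤ W N := hC ⟨N, hN, rfl⟩
    have h2 : |C| / (-u) * F N ≤ |C| / (-u) * u :=
      mul_le_mul_of_nonneg_left (hFS N hN).le (div_nonneg (abs_nonneg _) (by linarith))
    have h3 : |C| / (-u) * u = -|C| := by
      rw [div_mul_eq_mul_div, div_eq_iff (by linarith)]
      ring
    have h4 : h N = W N - |C| / (-u) * F N := by simp [hh]
    linarith [neg_abs_le C]
  rcases hM.trace_nonneg.eq_or_lt with h0 | hpos
  · rw [hM.trace_eq_zero_iff.mp h0.symm, map_zero]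
  · have := hhS (M.trace⁻¹ • M) ⟨hM.smul (inv_nonneg.mpr hpos.le), by
      rw [trace_smul, smul_eq_mul, inv_mul_cancel₀ hpos.ne']⟩
    rw [map_smul, smul_eq_mul] at this
    exact nonneg_of_mul_nonneg_right this (inv_pos.mpr hpos)

end PosSemidef

section Blocks

variable {p q : Type*}

lemma Matrix.PosSemidef.toBlocks₁₁ {M : Matrix (p ⊕ q) (p ⊕ q) ℝ} (hM : M.PosSemidef) :
    M.toBlocks₁₁.PosSemidef := hM.submatrix Sum.inl

lemma Matrix.PosSemidef.toBlocks₂₂ {M : Matrix (p ⊕ q) (p ⊕ q) ℝ} (hM : M.PosSemidef) :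
    M.toBlocks₂₂.PosSemidef := hM.submatrix Sum.inr

lemma Matrix.IsSymm.toBlocks₂₁_eq {M : Matrix (p ⊕ q) (p ⊕ q) ℝ} (hM : M.IsSymm) :
    M.toBlocks₂₁ = M.toBlocks₁₂ᵀ := by
  ext i j
  exact hM.apply _ _

lemma fromBlocks_one_zero_eq_diagonal [DecidableEq p] [DecidableEq q] :
    fromBlocks (1 : Matrix p p ℝ) 0 0 (0 : Matrix q q ℝ) = diagonal (Sum.elim 1 0) := by
  rw [← diagonal_one, ← diagonal_zero, fromBlocks_diagonal]
  rfl

lemma posSemidef_fromBlocks_one_zero [DecidableEq p] :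
    (fromBlocks (1 : Matrix p p ℝ) 0 0 (0 : Matrix q q ℝ)).PosSemidef := by
  classical
  rw [fromBlocks_one_zero_eq_diagonal]
  refine PosSemidef.diagonal fun i => ?_
  rcases i with i | i <;> simp

variable [Fintype p] [Fintype q]

lemma quadForm_fromBlocks (A : Matrix p p ℝ) (B : Matrix p q ℝ) (C : Matrix q p ℝ)
    (D : Matrix q q ℝ) (a : p → ℝ) (b : q → ℝ) :
    Sum.elim a b ⬝ᵥ fromBlocks A B C D *ᵥ Sum.elim a b =
      a ⬝ᵥ A *ᵥ a + a ⬝ᵥ B *ᵥ b + (b ⬝ᵥ C *ᵥ a + b ⬝ᵥ D *ᵥ b) := by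
  rw [fromBlocks_mulVec, sumElim_dotProduct_sumElim]
  simp [dotProduct_add]

lemma trace_mul_eq_trace_toBlocks (M Y : Matrix (p ⊕ q) (p ⊕ q) ℝ) :
    (M * Y).trace = (M.toBlocks₁₁ * Y.toBlocks₁₁).trace + (M.toBlocks₁₂ * Y.toBlocks₂₁).trace +
      ((M.toBlocks₂₁ * Y.toBlocks₁₂).trace + (M.toBlocks₂₂ * Y.toBlocks₂₂).trace) := by
  simp [trace, Fintype.sum_sum_type, mul_apply, Matrix.toBlocks₁₁, Matrix.toBlocks₁₂,
    Matrix.toBlocks₂₁, Matrix.toBlocks₂₂, Finset.sum_add_distrib]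
  ring

lemma Matrix.PosSemidef.apply_eq_zero_of_diag_eq_zero {ι : Type*} [Fintype ι] {M : Matrix ι ι ℝ}
    (hM : M.PosSemidef) {i : ι} (hi : M i i = 0) (j : ι) : M j i = 0 := by
  classical
  have h := (hM.dotProduct_mulVec_zero_iff (Pi.single i 1)).mp (by simpa using hi)
  simpa using congrFun h j

variable [DecidableEq p]

/-- A positive semidefinite matrix orthogonal to `diag(I, 0)` is supported on its lower-right
block. -/
lemma trace_mul_eq_trace_toBlocks₂₂ {Y : Matrix (p ⊕ q) (p ⊕ q) ℝ} (hY : Y.PosSemidef)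
    (hZY : (fromBlocks (1 : Matrix p p ℝ) 0 0 (0 : Matrix q q ℝ) * Y).trace = 0)
    (M : Matrix (p ⊕ q) (p ⊕ q) ℝ) :
    (M * Y).trace = (M.toBlocks₂₂ * Y.toBlocks₂₂).trace := by
  have h11 : Y.toBlocks₁₁ = 0 := by
    rw [← hY.toBlocks₁₁.trace_eq_zero_iff]
    simpa [trace_mul_eq_trace_toBlocks] using hZY
  have hcol (j : p ⊕ q) (i : p) : Y j (Sum.inl i) = 0 :=
    hY.apply_eq_zero_of_diag_eq_zero (congrFun (congrFun h11 i) i) j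
  have h21 : Y.toBlocks₂₁ = 0 := by
    ext j i
    exact hcol _ _
  have h12 : Y.toBlocks₁₂ = 0 := by
    rw [← transpose_eq_zero,
      ← (posSemidef_iff_isSymm_and_quadForm.mp hY).1.toBlocks₂₁_eq, h21]
  simp [trace_mul_eq_trace_toBlocks, h11, h12, h21]

/-- If adding `S` to `diag(I, 0)` does not increase the rank, then `S` vanishes outside the
upper-left block. -/
lemma toBlocks_eq_zero_of_rank_le {S : Matrix (p ⊕ q) (p ⊕ q) ℝ} (hS : S.PosSemidef)
    (hrank : ((1 / 2 : ℝ) • (fromBlocks (1 : Matrix p p ℝ) 0 0 (0 : Matrix q q ℝ) + S)).rank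
      ≤ Fintype.card p) :
    S.toBlocks₂₂ = 0 ∧ S.toBlocks₁₂ = 0 := by
  classical
  set Z : Matrix (p ⊕ q) (p ⊕ q) ℝ := fromBlocks (1 : Matrix p p ℝ) 0 0 (0 : Matrix q q ℝ)
  set T := (1 / 2 : ℝ) • (Z + S) with hT
  have hZd : Z = diagonal (Sum.elim 1 0) := fromBlocks_one_zero_eq_diagonal
  have hZpsd : Z.PosSemidef := posSemidef_fromBlocks_one_zero
  have hZrank : Fintype.card p ≤ Z.rank := by
    rw [hZd, rank_diagonal]
    exact Fintype.card_le_of_injective (fun i => ⟨Sum.inl i, by simp⟩) fun i j h =>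
      Sum.inl_injective (congrArg Subtype.val h)
  have hker (x : p ⊕ q → ℝ) (hx : T *ᵥ x = 0) : Z *ᵥ x = 0 ∧ S *ᵥ x = 0 := by
    have hsum : star x ⬝ᵥ Z *ᵥ x + star x ⬝ᵥ S *ᵥ x = 0 := by
      rw [← dotProduct_add, ← add_mulVec, show Z + S = (2 : ℝ) • T by rw [hT, smul_smul]; norm_num,
        smul_mulVec, hx, smul_zero, dotProduct_zero]
    have h1 := hZpsd.dotProduct_mulVec_nonneg x
    have h2 := hS.dotProduct_mulVec_nonneg x
    exact ⟨(hZpsd.dotProduct_mulVec_zero_iff x).mp (by linarith),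
      (hS.dotProduct_mulVec_zero_iff x).mp (by linarith)⟩
  have hle : LinearMap.ker T.mulVecLin ≤ LinearMap.ker Z.mulVecLin :=
    fun x hx => (hker x hx).1
  have heq : LinearMap.ker T.mulVecLin = LinearMap.ker Z.mulVecLin := by
    refine Submodule.eq_of_le_of_finrank_le hle ?_
    have h1 := T.mulVecLin.finrank_range_add_finrank_ker
    have h2 := Z.mulVecLin.finrank_range_add_finrank_ker
    have h3 : Module.finrank ℝ (LinearMap.range T.mulVecLin) ≤ Fintype.card p := hrank
    have h4 : Fintype.card p ≤ Module.finrank ℝ (LinearMap.range Z.mulVecLin) := hZrank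
    omega
  have hcol (i : p ⊕ q) (j : q) : S i (Sum.inr j) = 0 := by
    have hmem : Pi.single (Sum.inr j) 1 ∈ LinearMap.ker Z.mulVecLin := by
      rw [LinearMap.mem_ker, mulVecLin_apply, hZd]
      ext k
      rcases k with k | k <;> simp
    rw [← heq] at hmem
    simpa using congrFun (hker _ hmem).2 i
  constructor <;>
  · ext i j
    exact hcol _ _

/-- A matrix whose lower-right block is positive semidefinite, with column space containing that
of the lower-left block, is a feasible direction at `diag(I, 0)`. -/
lemma exists_posSemidef_add_smul {V : Matrix (p ⊕ q) (p ⊕ q) ℝ} (hV : V.IsSymm)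
    (h22 : V.toBlocks₂₂.PosSemidef) (N : Matrix q p ℝ)
    (hN : V.toBlocks₁₂ᵀ = V.toBlocks₂₂ * N) :
    ∃ ε > 0, (fromBlocks (1 : Matrix p p ℝ) 0 0 (0 : Matrix q q ℝ) + (ε : ℝ) • V).PosSemidef := by
  set D := V.toBlocks₂₂
  obtain ⟨hDs, hDq⟩ := posSemidef_iff_isSymm_and_quadForm.mp h22
  obtain ⟨t, ht, hbound⟩ := exists_abs_quadForm_le (V.toBlocks₁₁ - Nᵀ * D * N)
  refine ⟨t⁻¹, inv_pos.mpr ht, posSemidef_iff_isSymm_and_quadForm.mpr ⟨?_, fun x => ?_⟩⟩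
  · refine IsSymm.add ?_ (hV.smul _)
    simp [IsSymm, fromBlocks_transpose]
  obtain ⟨a, b, rfl⟩ : ∃ a b, x = Sum.elim a b := ⟨_, _, (Sum.elim_comp_inl_inr x).symm⟩
  have hVx : Sum.elim a b ⬝ᵥ V *ᵥ Sum.elim a b =
      a ⬝ᵥ (V.toBlocks₁₁ - Nᵀ * D * N) *ᵥ a + (b + N *ᵥ a) ⬝ᵥ D *ᵥ (b + N *ᵥ a) := by
    have hca : V.toBlocks₂₁ *ᵥ a = D *ᵥ N *ᵥ a := by
      rw [hV.toBlocks₂₁_eq, hN, mulVec_mulVec]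
    have hab : a ⬝ᵥ V.toBlocks₁₂ *ᵥ b = b ⬝ᵥ D *ᵥ N *ᵥ a := by
      rw [← hca, hV.toBlocks₂₁_eq, mulVec_transpose, dotProduct_mulVec, dotProduct_comm]
    have hcb : (N *ᵥ a) ⬝ᵥ D *ᵥ b = b ⬝ᵥ D *ᵥ N *ᵥ a := by
      rw [dotProduct_mulVec, ← mulVec_transpose, hDs.eq, dotProduct_comm]
    have hcc : a ⬝ᵥ (Nᵀ * D * N) *ᵥ a = (N *ᵥ a) ⬝ᵥ D *ᵥ N *ᵥ a := by
      rw [Matrix.mul_assoc, ← mulVec_mulVec, ← mulVec_mulVec, mulVec_transpose,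
        dotProduct_comm, ← dotProduct_mulVec, dotProduct_comm]
    conv_lhs => rw [← fromBlocks_toBlocks V, quadForm_fromBlocks]
    rw [sub_mulVec, dotProduct_sub, hcc, mulVec_add, dotProduct_add, add_dotProduct,
      add_dotProduct, hcb, hab, hca]
    ring
  have hb := (abs_le.mp (hbound a)).1
  have hnn := hDq (b + N *ᵥ a)
  rw [add_mulVec, dotProduct_add, quadForm_fromBlocks, smul_mulVec, dotProduct_smul, hVx,
    smul_eq_mul]
  simp only [one_mulVec, zero_mulVec, dotProduct_zero, add_zero]
  rw [← mul_le_mul_iff_of_pos_left ht, mul_zero, mul_add, mul_inv_cancel_left₀ ht.ne']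
  linarith

end Blocks

section Duality

variable {p q : Type*} [Fintype p] [Fintype q] [DecidableEq p]
  {X : Type*} [AddCommGroup X] [Module ℝ X]

/-- A direction with positive semidefinite lower-right block and nonzero upper-right block yields
an objective that is zero on the feasible set but has no dual solution of value zero. -/
lemma exists_objective_without_dual_solution (L : X →ₗ[ℝ] Matrix (p ⊕ q) (p ⊕ q) ℝ)
    (hface : ∀ y, (fromBlocks (1 : Matrix p p ℝ) 0 0 (0 : Matrix q q ℝ) - L y).PosSemidef →
      (L y).toBlocks₂₂ = 0 ∧ (L y).toBlocks₁₂ = 0)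
    {x : X} (h22 : (L x).toBlocks₂₂.PosSemidef) (h12 : (L x).toBlocks₁₂ ≠ 0) :
    ∃ φ : X →ₗ[ℝ] ℝ,
      (∀ y, (fromBlocks (1 : Matrix p p ℝ) 0 0 (0 : Matrix q q ℝ) - L y).PosSemidef → φ y = 0) ∧
      ∀ Y : Matrix (p ⊕ q) (p ⊕ q) ℝ, Y.PosSemidef → (∀ y, (L y * Y).trace = φ y) →
        (fromBlocks (1 : Matrix p p ℝ) 0 0 (0 : Matrix q q ℝ) * Y).trace ≠ 0 := by
  let φ : X →ₗ[ℝ] ℝ :=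
    { toFun := fun y => -((L x).toBlocks₁₂ᴴ * (L y).toBlocks₁₂).trace
      map_add' := fun y z => by
        rw [map_add, show (L y + L z).toBlocks₁₂ = (L y).toBlocks₁₂ + (L z).toBlocks₁₂ from rfl,
          Matrix.mul_add, trace_add, neg_add]
      map_smul' := fun c y => by
        rw [map_smul, show (c • L y).toBlocks₁₂ = c • (L y).toBlocks₁₂ from rfl,
          Matrix.mul_smul, trace_smul, smul_neg, RingHom.id_apply] }
  have hφ (y : X) : φ y = -((L x).toBlocks₁₂ᴴ * (L y).toBlocks₁₂).trace := rfl
  refine ⟨φ, fun y hy => by simp [hφ, (hface y hy).2], fun Y hY hYφ hZY => ?_⟩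
  have h1 := hYφ x
  rw [trace_mul_eq_trace_toBlocks₂₂ hY hZY, hφ] at h1
  have h2 := h22.trace_mul_nonneg hY.toBlocks₂₂
  have h3 := (posSemidef_conjTranspose_mul_self (L x).toBlocks₁₂).trace_nonneg
  exact h12 (trace_conjTranspose_mul_self_eq_zero_iff.mp (by linarith))

/-- If the lower-right blocks meet the positive semidefinite cone only at zero, and their
vanishing forces that of the upper-right blocks, then the dual optimum is attained. -/
lemma exists_dual_solution (L : X →ₗ[ℝ] Matrix (p ⊕ q) (p ⊕ q) ℝ) (hL : ∀ x, (L x).IsSymm)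
    (hface : ∀ y, (fromBlocks (1 : Matrix p p ℝ) 0 0 (0 : Matrix q q ℝ) - L y).PosSemidef →
      (L y).toBlocks₂₂ = 0)
    (hgood : ∀ x, (L x).toBlocks₂₂.PosSemidef → (L x).toBlocks₂₂ = 0 ∧ (L x).toBlocks₁₂ = 0)
    (φ : X →ₗ[ℝ] ℝ) {v : ℝ}
    (hv : IsLUB {s | ∃ y, (fromBlocks (1 : Matrix p p ℝ) 0 0 (0 : Matrix q q ℝ)
      - L y).PosSemidef ∧ s = φ y} v) :
    ∃ Y : Matrix (p ⊕ q) (p ⊕ q) ℝ, Y.PosSemidef ∧ (∀ y, (L y * Y).trace = φ y) ∧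
      (fromBlocks (1 : Matrix p p ℝ) 0 0 (0 : Matrix q q ℝ) * Y).trace = v := by
  let L₂₂ : X →ₗ[ℝ] Matrix q q ℝ :=
    { toFun := fun y => (L y).toBlocks₂₂
      map_add' := fun y z => by rw [map_add]; rfl
      map_smul' := fun c y => by rw [map_smul]; rfl }
  let L₁₁ : X →ₗ[ℝ] Matrix p p ℝ :=
    { toFun := fun y => (L y).toBlocks₁₁
      map_add' := fun y z => by rw [map_add]; rfl
      map_smul' := fun c y => by rw [map_smul]; rfl }
  let K := LinearMap.ker L₂₂
  have hfeas (y : K) (t : ℝ) (a : p → ℝ) (b : q → ℝ) :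
      Sum.elim a b ⬝ᵥ (fromBlocks (t • (1 : Matrix p p ℝ)) 0 0 (0 : Matrix q q ℝ) - L y) *ᵥ
        Sum.elim a b = a ⬝ᵥ (t • (1 : Matrix p p ℝ) - L₁₁ y) *ᵥ a := by
    have hy22 : (L y).toBlocks₂₂ = 0 := y.2
    have hy12 : (L y).toBlocks₁₂ = 0 := (hgood y (by rw [hy22]; exact PosSemidef.zero)).2
    have hy21 : (L y).toBlocks₂₁ = 0 := by rw [(hL y).toBlocks₂₁_eq, hy12, transpose_zero]
    rw [← fromBlocks_toBlocks (L y), hy22, hy12, hy21, sub_mulVec, sub_mulVec, dotProduct_sub,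
      dotProduct_sub, quadForm_fromBlocks, quadForm_fromBlocks]
    simp [L₁₁]
  have hpsd (y : K) (hy : (1 : Matrix p p ℝ) - L₁₁ y ∈ quadFormCone p) : φ y ≤ v := by
    refine hv.1 ⟨y, posSemidef_iff_isSymm_and_quadForm.mpr ⟨?_, fun x => ?_⟩, rfl⟩
    · refine IsSymm.sub ?_ (hL y)
      simp [IsSymm, fromBlocks_transpose]
    · obtain ⟨a, b, rfl⟩ : ∃ a b, x = Sum.elim a b := ⟨_, _, (Sum.elim_comp_inl_inr x).symm⟩
      have := hfeas y 1 a b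
      rw [one_smul] at this
      rw [this]
      exact hy a
  let f : ℝ × K →ₗ[ℝ] Matrix p p ℝ :=
    (LinearMap.toSpanSingleton ℝ _ (1 : Matrix p p ℝ)).coprod (-(L₁₁.comp K.subtype))
  let χ : ℝ × K →ₗ[ℝ] ℝ :=
    (LinearMap.toSpanSingleton ℝ ℝ v).coprod (-(φ.comp K.subtype))
  have hf (t : ℝ) (y : K) : f (t, y) = t • (1 : Matrix p p ℝ) - L₁₁ y := by
    simp [f, sub_eq_add_neg]
  have hχ (t : ℝ) (y : K) : χ (t, y) = t * v - φ y := by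
    simp [χ, sub_eq_add_neg]
  obtain ⟨g, hgf, hg⟩ := exists_nonneg_functional_comp_eq (quadFormCone p) f χ
    (by
      rintro ⟨t, y⟩ hty
      rw [hf] at hty
      rw [hχ, sub_nonneg]
      obtain ⟨a, ha, hat⟩ : ∃ a : ℝ, 0 < a ∧ 0 < a + t :=
        ⟨1 + |t|, by positivity, by linarith [neg_abs_le t]⟩
      have hub : v ≤ ((a + t) * v - φ y) / a := by
        refine hv.2 ?_
        rintro _ ⟨z, hz, rfl⟩
        let z' : K := ⟨z, hface z hz⟩
        have hz11 : (1 : Matrix p p ℝ) - L₁₁ z' ∈ quadFormCone p := by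
          intro c
          have := (posSemidef_iff_isSymm_and_quadForm.mp hz).2 (Sum.elim c 0)
          have h1 := hfeas z' 1 c 0
          rw [one_smul] at h1
          rwa [h1] at this
        have hcomb := hpsd ((a + t)⁻¹ • (a • z' + y)) (by
          have h := (quadFormCone p).smul_mem (inv_pos.mpr hat).le
            ((quadFormCone p).add_mem
              ((quadFormCone p).smul_mem ha.le hz11) hty)
          convert h using 1
          change _ = (a + t)⁻¹ • (a • ((1 : Matrix p p ℝ) - L₁₁ z') + (t • 1 - L₁₁ y))
          rw [show a • ((1 : Matrix p p ℝ) - L₁₁ z') + (t • 1 - L₁₁ y) =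
            (a + t) • 1 - (a • L₁₁ z' + L₁₁ y) by module, smul_sub, smul_smul,
            inv_mul_cancel₀ hat.ne', one_smul]
          simp)
        simp only [Submodule.coe_smul, Submodule.coe_add, map_smul, map_add, smul_eq_mul] at hcomb
        rw [inv_mul_le_iff₀ hat] at hcomb
        rw [le_div_iff₀ ha]
        change a * φ z + _ ≤ _ at hcomb
        linarith
      rw [le_div_iff₀ ha] at hub
      linarith)
    (by
      intro M
      obtain ⟨t, -, ht⟩ := exists_abs_quadForm_le M
      refine ⟨(t, 0), fun a => ?_⟩
      rw [hf, add_mulVec, dotProduct_add]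
      have h := (abs_le.mp (ht a)).1
      simp only [Submodule.coe_zero, map_zero, sub_zero, smul_mulVec, one_mulVec, dotProduct_smul,
        smul_eq_mul]
      linarith)
  have hg1 : g 1 = v := by
    have := hgf (1, 0)
    rw [hf, hχ] at this
    simpa using this
  obtain ⟨h, hhψ, hh⟩ := exists_nonneg_on_posSemidef_comp_eq L₂₂ (fun x hx => (hgood x hx).1)
    (φ - g.comp L₁₁) (fun x hx => by
      have := hgf (0, ⟨x, hx⟩)
      rw [hf, hχ] at this
      simp only [zero_smul, zero_sub, zero_mul, map_neg, neg_inj] at this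
      simp [this])
  let G : Matrix (p ⊕ q) (p ⊕ q) ℝ →ₗ[ℝ] ℝ :=
    { toFun := fun M => g M.toBlocks₁₁ + h M.toBlocks₂₂
      map_add' := fun M N => by
        rw [show (M + N).toBlocks₁₁ = M.toBlocks₁₁ + N.toBlocks₁₁ from rfl,
          show (M + N).toBlocks₂₂ = M.toBlocks₂₂ + N.toBlocks₂₂ from rfl, map_add, map_add]
        ring
      map_smul' := fun c M => by
        rw [show (c • M).toBlocks₁₁ = c • M.toBlocks₁₁ from rfl,
          show (c • M).toBlocks₂₂ = c • M.toBlocks₂₂ from rfl, map_smul, map_smul, smul_add,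
          RingHom.id_apply] }
  have hG (M : Matrix (p ⊕ q) (p ⊕ q) ℝ) : G M = g M.toBlocks₁₁ + h M.toBlocks₂₂ := rfl
  obtain ⟨Y, hY, hYG⟩ := exists_posSemidef_trace_mul_eq G fun M hM => add_nonneg
    (hg _ (posSemidef_iff_isSymm_and_quadForm.mp hM.toBlocks₁₁).2)
    (hh _ hM.toBlocks₂₂)
  refine ⟨Y, hY, fun y => ?_, ?_⟩
  · rw [hYG _ (hL y), hG]
    have := hhψ y
    change h (L y).toBlocks₂₂ = φ y - g (L y).toBlocks₁₁ at this
    linarith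
  · rw [hYG _ (by simp [IsSymm, fromBlocks_transpose]), hG]
    simpa using hg1

end Duality

section Reindexing

lemma exists_eq_mul_of_colSpace_le {k l s : ℕ} {P : Matrix (Fin k) (Fin l) ℝ}
    {D : Matrix (Fin k) (Fin s) ℝ} (h : colSpace P ≤ colSpace D) :
    ∃ N : Matrix (Fin s) (Fin l) ℝ, P = D * N := by
  have hcol (j : Fin l) : ∃ w, D *ᵥ w = P.col j := by
    obtain ⟨w, hw⟩ := h ⟨Pi.single j 1, rfl⟩
    exact ⟨w, by simpa using hw⟩
  choose w hw using hcol
  refine ⟨(of w)ᵀ, ?_⟩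
  ext i j
  exact (congrFun (hw j) i).symm

lemma trace_submatrix_mul_submatrix {ι κ : Type*} [Fintype ι] [Fintype κ] (e : κ ≃ ι)
    (M Y : Matrix ι ι ℝ) : (M.submatrix e e * Y.submatrix e e).trace = (M * Y).trace := by
  rw [submatrix_mul_equiv]
  exact e.sum_comp fun i => (M * Y) i i

/-- Splitting of the index set into the first `r` and the last `n - r` indices. -/
def blockEquiv {n r : ℕ} (h : r ≤ n) : Fin r ⊕ Fin (n - r) ≃ Fin n :=
  finSumFinEquiv.trans (finCongr (Nat.add_sub_cancel' h))

/-- The linear map `x ↦ ∑ xᵢ Aᵢ`, written in block form. -/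
def blockPencil {n m r : ℕ} (h : r ≤ n) (A : Fin m → Matrix (Fin n) (Fin n) ℝ) :
    (Fin m → ℝ) →ₗ[ℝ] Matrix (Fin r ⊕ Fin (n - r)) (Fin r ⊕ Fin (n - r)) ℝ where
  toFun x := (∑ i, x i • A i).submatrix (blockEquiv h) (blockEquiv h)
  map_add' x y := by
    ext i j
    simp [add_smul, Finset.sum_add_distrib]
  map_smul' c x := by
    ext i j
    simp [Matrix.sum_apply, Finset.mul_sum, mul_assoc]

variable {n m r : ℕ} (h : r ≤ n)

lemma blockPencil_apply (A : Fin m → Matrix (Fin n) (Fin n) ℝ) (x : Fin m → ℝ) :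
    blockPencil h A x = (∑ i, x i • A i).submatrix (blockEquiv h) (blockEquiv h) := rfl

lemma isSymm_blockPencil {A : Fin m → Matrix (Fin n) (Fin n) ℝ} (hA : ∀ i, (A i).IsSymm)
    (x : Fin m → ℝ) : (blockPencil h A x).IsSymm := by
  refine IsSymm.submatrix ?_ _
  rw [IsSymm, transpose_sum]
  exact Finset.sum_congr rfl fun i _ => (hA i).smul _

lemma toBlocks₂₂_blockPencil (A : Fin m → Matrix (Fin n) (Fin n) ℝ) (x : Fin m → ℝ) :
    (blockPencil h A x).toBlocks₂₂ = block22 r h (∑ i, x i • A i) := rfl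

lemma toBlocks₁₂_blockPencil (A : Fin m → Matrix (Fin n) (Fin n) ℝ) (x : Fin m → ℝ) :
    (blockPencil h A x).toBlocks₁₂ = block12 r h (∑ i, x i • A i) := rfl

lemma Zmat_submatrix_blockEquiv :
    (Zmat n r).submatrix (blockEquiv h) (blockEquiv h) =
      fromBlocks (1 : Matrix (Fin r) (Fin r) ℝ) 0 0 (0 : Matrix (Fin (n - r)) (Fin (n - r)) ℝ) := by
  ext i j
  rcases i with i | i <;> rcases j with j | j <;>
    simp [Zmat, blockEquiv, one_apply, Fin.ext_iff]
  omega

end Reindexing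

lemma slack_submatrix_blockEquiv {n m r : ℕ} (h : r ≤ n) {A : Fin m → Matrix (Fin n) (Fin n) ℝ}
    {B : Matrix (Fin n) (Fin n) ℝ} {x₀ : Fin m → ℝ} (hx₀ : B - ∑ i, x₀ i • A i = Zmat n r)
    (x : Fin m → ℝ) :
    (B - ∑ i, x i • A i).submatrix (blockEquiv h) (blockEquiv h) =
      fromBlocks (1 : Matrix (Fin r) (Fin r) ℝ) 0 0 (0 : Matrix (Fin (n - r)) (Fin (n - r)) ℝ) -
        blockPencil h A (x - x₀) := by
  rw [map_sub, ← Zmat_submatrix_blockEquiv h, ← hx₀]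
  simp only [blockPencil_apply, submatrix_sub, Pi.sub_apply]
  abel

/-- Under the maximum rank slack assumption, the feasible system
`∑ xᵢ Aᵢ ⪯ B` is badly behaved iff the "Bad condition" holds. -/
theorem stmt0 {n m : ℕ} (hn : 0 < n) (hm : 0 < m)
    (A : Fin m → Matrix (Fin n) (Fin n) ℝ) (B : Matrix (Fin n) (Fin n) ℝ)
    (hA : ∀ i, (A i).IsSymm) (hB : B.IsSymm)
    (hfeas : ∃ x : Fin m → ℝ, IsFeasible A B x)
    (r : ℕ) (hr : r ≤ n) (hZ : MaxRankSlack A B r) :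
    BadlyBehaved A B ↔ BadCond A r hr := by
  obtain ⟨⟨x₀, hx₀⟩, hmax⟩ := hZ
  set e := blockEquiv hr
  set L := blockPencil hr A with hLdef
  set Z := fromBlocks (1 : Matrix (Fin r) (Fin r) ℝ) 0 0
    (0 : Matrix (Fin (n - r)) (Fin (n - r)) ℝ)
  have hslack := slack_submatrix_blockEquiv hr hx₀
  have hfeas_iff (x : Fin m → ℝ) : IsFeasible A B x ↔ (Z - L (x - x₀)).PosSemidef := by
    rw [← hslack, posSemidef_submatrix_equiv]
    rfl
  have hface (y : Fin m → ℝ) (hy : (Z - L y).PosSemidef) :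
      (L y).toBlocks₂₂ = 0 ∧ (L y).toBlocks₁₂ = 0 := by
    have hmid : (1 / 2 : ℝ) • (Z + (Z - L y)) = Z - L ((1 / 2 : ℝ) • y) := by
      rw [map_smul]
      module
    have hrank : ((1 / 2 : ℝ) • (Z + (Z - L y))).rank ≤ Fintype.card (Fin r) := by
      have hfeasible : IsFeasible A B ((1 / 2 : ℝ) • y + x₀) := by
        rw [hfeas_iff, add_sub_cancel_right, ← hmid]
        exact (posSemidef_fromBlocks_one_zero.add hy).smul (by norm_num)
      have := hmax _ hfeasible
      rw [Fintype.card_fin]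
      rwa [← rank_submatrix _ e e, hslack, add_sub_cancel_right, ← hmid] at this
    obtain ⟨h22, h12⟩ := toBlocks_eq_zero_of_rank_le hy hrank
    exact ⟨neg_eq_zero.mp ((zero_sub _).symm.trans h22),
      neg_eq_zero.mp ((zero_sub _).symm.trans h12)⟩
  have htr (M Y : Matrix (Fin n) (Fin n) ℝ) :
      ip M Y = (M.submatrix e e * Y.submatrix e e).trace :=
    (trace_submatrix_mul_submatrix e M Y).symm
  have hpencil (y : Fin m → ℝ) (Y : Matrix (Fin n) (Fin n) ℝ) :
      (L y * Y.submatrix e e).trace = ∑ i, y i * ip (A i) Y := by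
    rw [hLdef, blockPencil_apply, trace_submatrix_mul_submatrix, Finset.sum_mul, trace_sum]
    exact Finset.sum_congr rfl fun i _ => by rw [smul_mul, trace_smul, smul_eq_mul, ip]
  have hBY (Y : Matrix (Fin n) (Fin n) ℝ) :
      ip B Y = (Z * Y.submatrix e e).trace + ∑ i, x₀ i * ip (A i) Y := by
    rw [← hpencil, ← trace_add, ← Matrix.add_mul, htr]
    have := hslack 0
    simp only [Pi.zero_apply, zero_smul, Finset.sum_const_zero, sub_zero, zero_sub, map_neg,
      sub_neg_eq_add] at this
    rw [this]
  constructor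
  · rintro ⟨c, v, hv, hno⟩
    by_contra hbad
    have hgood (x : Fin m → ℝ) (hx : (L x).toBlocks₂₂.PosSemidef) :
        (L x).toBlocks₂₂ = 0 ∧ (L x).toBlocks₁₂ = 0 := by
      have hcs : colSpace (L x).toBlocks₁₂ᵀ ≤ colSpace (L x).toBlocks₂₂ := by
        by_contra hcs
        exact hbad ⟨x, hx, hcs⟩
      obtain ⟨N, hN⟩ := exists_eq_mul_of_colSpace_le hcs
      obtain ⟨ε, hε, hpsd⟩ := exists_posSemidef_add_smul (isSymm_blockPencil hr hA x) hx N hN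
      obtain ⟨h22, h12⟩ := hface (-ε • x) (by simpa [map_smul] using hpsd)
      rw [map_smul] at h22 h12
      have hne : -ε ≠ 0 := neg_ne_zero.mpr hε.ne'
      exact ⟨(smul_eq_zero_iff_right hne).mp h22, (smul_eq_zero_iff_right hne).mp h12⟩
    let φ : (Fin m → ℝ) →ₗ[ℝ] ℝ := Fintype.linearCombination ℝ c
    have hφ (y : Fin m → ℝ) : φ y = ∑ i, c i * y i := by
      simp [φ, Fintype.linearCombination_apply, mul_comm]
    have hlub : IsLUB {s | ∃ y, (Z - L y).PosSemidef ∧ s = φ y} (v - φ x₀) := by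
      constructor
      · rintro _ ⟨y, hy, rfl⟩
        have := hv.1 ⟨y + x₀, (hfeas_iff _).mpr (by rwa [add_sub_cancel_right]), rfl⟩
        rw [← hφ, map_add] at this
        linarith
      · intro b hb
        have : v ≤ b + φ x₀ := hv.2 (by
          rintro _ ⟨x, hx, rfl⟩
          have := hb ⟨x - x₀, (hfeas_iff x).mp hx, rfl⟩
          rw [map_sub] at this
          rw [← hφ]
          linarith)
        linarith
    obtain ⟨Y, hY, hYφ, hYv⟩ := exists_dual_solution L (isSymm_blockPencil hr hA)
      (fun y hy => (hface y hy).1) hgood φ hlub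
    have hYe : (Y.submatrix e.symm e.symm).submatrix e e = Y := by simp
    have hYc (i : Fin m) : ip (A i) (Y.submatrix e.symm e.symm) = c i := by
      have h1 := hpencil (Pi.single i 1) (Y.submatrix e.symm e.symm)
      rw [hYe, hYφ, hφ] at h1
      simpa [Pi.single_apply] using h1.symm
    refine hno ⟨Y.submatrix e.symm e.symm, hY.submatrix _, hYc, ?_⟩
    rw [hBY, hYe, hYv, ← hpencil, hYe, hYφ]
    ring
  · rintro ⟨x, h22, hcs⟩
    have h12 : (L x).toBlocks₁₂ ≠ 0 := by
      intro h0
      refine hcs ?_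
      rw [← toBlocks₁₂_blockPencil hr A x, h0, colSpace]
      simp
    obtain ⟨φ, hφ, hno⟩ := exists_objective_without_dual_solution L hface h22 h12
    have hφs (y : Fin m → ℝ) : ∑ i, φ (Pi.single i 1) * y i = φ y := by
      conv_rhs => rw [pi_eq_sum_univ' y]
      simp [map_sum, mul_comm]
    have hconst (z : Fin m → ℝ) (hz : IsFeasible A B z) : φ z = φ x₀ := by
      have := hφ _ ((hfeas_iff z).mp hz)
      rwa [map_sub, sub_eq_zero] at this
    refine ⟨fun i => φ (Pi.single i 1), φ x₀, ⟨?_, ?_⟩, ?_⟩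
    · rintro _ ⟨z, hz, rfl⟩
      rw [hφs, hconst z hz]
    · intro b hb
      obtain ⟨z, hz⟩ := hfeas
      exact hb ⟨z, hz, by rw [hφs, hconst z hz]⟩
    · rintro ⟨Y, hY, hYc, hYv⟩
      have hpair (y : Fin m → ℝ) : (L y * Y.submatrix e e).trace = φ y := by
        rw [hpencil, ← hφs]
        exact Finset.sum_congr rfl fun i _ => by rw [hYc, mul_comm]
      refine hno (Y.submatrix e e) (hY.submatrix _) hpair ?_
      rw [hBY, ← hpencil, hpair] at hYv
      linarith
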